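/- Let w > 0, and let n, r, s, t be integers satisfying 2 ≤ n+1 ≤ s and 2w < t. If F is an unsatisfiable CNF consisting of r clauses in n variables, then every resolution refutation of REF^F_{s,t} has index-width greater than w. -/

import Mathlib

open Classical Finset

structure Lit (V : Type) where
  var : V
  pos : Bool
deriving DecidableEq

abbrev Clause (V : Type) := Finset (Lit V)
abbrev PTerm (V : Type) := Finset (Lit V)
abbrev Cnf (V : Type) := Finset (Clause V)
abbrev Dnf (V : Type) := Finset (PTerm V)

variable {V : Type} [DecidableEq V]

def Lit.neg (l : Lit V) : Lit V := ⟨l.var, !l.pos⟩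

/-- A clause viewed as a 1-DNF. -/
def clauseToDnf (C : Clause V) : Dnf V := C.image (fun l => {l})

/-- A `k`-DNF: every term has at most `k` literals. -/
def IsKDnf (k : ℕ) (G : Dnf V) : Prop := ∀ q ∈ G, q.card ≤ k

/-- The inference rules of Res(k): axiom, weakening, ∧-introduction and cut. -/
inductive ResKInf (k : ℕ) : List (Dnf V) → Dnf V → Prop
  | ax (x : V) :
      ResKInf k [] {{(⟨x, true⟩ : Lit V)}, {(⟨x, false⟩ : Lit V)}}
  | weaken (A B : Dnf V) : ResKInf k [A] (A ∪ B)
  | andIntro (A B : Dnf V) (l : Lit V) (q : PTerm V) (hq : q.card + 1 ≤ k) :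
      ResKInf k [A ∪ {({l} : PTerm V)}, B ∪ {q}] (A ∪ B ∪ {insert l q})
  | cut (A B : Dnf V) (q : PTerm V) :
      ResKInf k [A ∪ {q}, B ∪ q.image (fun l => ({l.neg} : PTerm V))] (A ∪ B)

/-- A Res(k) refutation of the CNF `F`: a sequence of k-DNFs, each a clause of `F`
or inferred from earlier lines, ending with the empty clause. -/
def IsResKRefutation (k : ℕ) (F : Set (Clause V)) (P : List (Dnf V)) : Prop :=
  P ≠ [] ∧ P.getLast? = some (∅ : Dnf V) ∧ (∀ G ∈ P, IsKDnf k G) ∧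
  ∀ i : Fin P.length,
    (∃ C ∈ F, P.get i = clauseToDnf C) ∨
    ∃ prems : List (Dnf V), ResKInf k prems (P.get i) ∧
      ∀ Q ∈ prems, ∃ j : Fin P.length, (j : ℕ) < (i : ℕ) ∧ P.get j = Q

/-- The number of symbols in a DNF. -/
def dnfSize (G : Dnf V) : ℕ := ∑ q ∈ G, (q.card + 1)

/-- The size (number of symbols) of a Res(k) refutation. -/
def proofSize (P : List (Dnf V)) : ℕ := (P.map dnfSize).sum

/-- The size (number of symbols) of a CNF. -/
def cnfSize (F : Cnf V) : ℕ := ∑ C ∈ F, (C.card + 1)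

/-- The set of propositional variables occurring in a CNF. -/
def cnfVars (F : Cnf V) : Finset V := F.sup (fun C => C.image Lit.var)

def SatClauseA (a : V → Bool) (C : Clause V) : Prop := ∃ l ∈ C, a l.var = l.pos

/-- Unsatisfiability of a CNF. -/
def Unsat (F : Set (Clause V)) : Prop := ¬ ∃ a : V → Bool, ∀ C ∈ F, SatClauseA a C

def litSatP (π : V → Option Bool) (l : Lit V) : Prop := π l.var = some l.pos
def litFalsP (π : V → Option Bool) (l : Lit V) : Prop := π l.var = some (!l.pos)

/-- A partial assignment satisfies a term if it satisfies all its literals. -/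
def satPTerm (π : V → Option Bool) (q : PTerm V) : Prop := ∀ l ∈ q, litSatP π l
/-- A partial assignment falsifies a term if it falsifies some literal of it. -/
def falsPTerm (π : V → Option Bool) (q : PTerm V) : Prop := ∃ l ∈ q, litFalsP π l

/-- The restriction of a DNF by a partial assignment: falsified terms are removed,
and satisfied literals are removed from the remaining terms. -/
noncomputable def restrictDnf (G : Dnf V) (π : V → Option Bool) : Dnf V :=
  (G.filter (fun q => ¬ falsPTerm π q)).image (fun q => q.filter (fun l => ¬ litSatP π l))

def clauseSatP (π : V → Option Bool) (C : Clause V) : Prop := ∃ l ∈ C, litSatP π l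

/-- The restriction of a clause: falsified literals are removed. -/
noncomputable def restrictClause (C : Clause V) (π : V → Option Bool) : Clause V :=
  C.filter (fun l => ¬ litFalsP π l)

/-- The restriction of a CNF by a partial assignment: satisfied clauses are removed,
falsified literals are removed from the remaining clauses. -/
def restrictCnfSet (F : Set (Clause V)) (π : V → Option Bool) : Set (Clause V) :=
  {E | ∃ C ∈ F, ¬ clauseSatP π C ∧ E = restrictClause C π}

/-- A resolution refutation of the CNF `F` (weakening is built into the rules). -/
def IsResRefutation (F : Set (Clause V)) (P : List (Clause V)) : Prop :=
  P ≠ [] ∧ P.getLast? = some (∅ : Clause V) ∧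
  ∀ i : Fin P.length,
    (∃ C ∈ F, C ⊆ P.get i) ∨
    ∃ jv jw : Fin P.length, (jv : ℕ) < (i : ℕ) ∧ (jw : ℕ) < (i : ℕ) ∧ ∃ x : V,
      (⟨x, true⟩ : Lit V) ∈ P.get jv ∧ (⟨x, false⟩ : Lit V) ∈ P.get jw ∧
      ((P.get jv).erase ⟨x, true⟩ ∪ (P.get jw).erase ⟨x, false⟩) ⊆ P.get i

/-- The variables of the formula `REF^F_{s,t}`. -/
inductive RefVar : Type
  | D (i j ℓ : ℕ) (b : Bool)
  | L (i j j' : ℕ)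
  | R (i j j' : ℕ)
  | V (i j ℓ : ℕ)
  | I (j m : ℕ)
deriving DecidableEq

/-- The home pair of a variable of `REF^F_{s,t}`. -/
def RefVar.homePair : RefVar → ℕ × ℕ
  | .D i j _ _ => (i, j)
  | .L i j _ => (i, j)
  | .R i j _ => (i, j)
  | .V i j _ => (i, j)
  | .I j _ => (1, j)

/-- The variable is one of the variables of `REF^F_{s,t}` (indices in range). -/
def RefVar.valid (n r s t : ℕ) : RefVar → Prop
  | .D i j ℓ _ => i ∈ Finset.Icc 1 s ∧ j ∈ Finset.Icc 1 t ∧ ℓ ∈ Finset.Icc 1 n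
  | .L i j j' => i ∈ Finset.Icc 2 s ∧ j ∈ Finset.Icc 1 t ∧ j' ∈ Finset.Icc 1 t
  | .R i j j' => i ∈ Finset.Icc 2 s ∧ j ∈ Finset.Icc 1 t ∧ j' ∈ Finset.Icc 1 t
  | .V i j ℓ => i ∈ Finset.Icc 2 s ∧ j ∈ Finset.Icc 1 t ∧ ℓ ∈ Finset.Icc 1 n
  | .I j m => j ∈ Finset.Icc 1 t ∧ m ∈ Finset.Icc 1 r

/-- The clauses of `REF^F_{s,t}`, where `F` has the `r` clauses `Cm 1, …, Cm r` in the
`n` variables `x_1, …, x_n` (a variable of `F` is represented by its index in `[n]`). -/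
inductive RefClause (Cm : ℕ → Clause ℕ) (n r s t : ℕ) : Clause RefVar → Prop
  | ax {j m ℓ : ℕ} {b : Bool} (hj : j ∈ Finset.Icc 1 t) (hm : m ∈ Finset.Icc 1 r)
      (hℓ : ℓ ∈ Finset.Icc 1 n) (hmem : (⟨ℓ, b⟩ : Lit ℕ) ∈ Cm m) :
      RefClause Cm n r s t {⟨.I j m, false⟩, ⟨.D 1 j ℓ b, true⟩}
  | nontaut {i j ℓ : ℕ} (hi : i ∈ Finset.Icc 1 s) (hj : j ∈ Finset.Icc 1 t)
      (hℓ : ℓ ∈ Finset.Icc 1 n) :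
      RefClause Cm n r s t {⟨.D i j ℓ true, false⟩, ⟨.D i j ℓ false, false⟩}
  | lcut {i j j' ℓ : ℕ} (hi : i ∈ Finset.Icc 2 s) (hj : j ∈ Finset.Icc 1 t)
      (hj' : j' ∈ Finset.Icc 1 t) (hℓ : ℓ ∈ Finset.Icc 1 n) :
      RefClause Cm n r s t {⟨.L i j j', false⟩, ⟨.V i j ℓ, false⟩, ⟨.D (i-1) j' ℓ true, true⟩}
  | rcut {i j j' ℓ : ℕ} (hi : i ∈ Finset.Icc 2 s) (hj : j ∈ Finset.Icc 1 t)
      (hj' : j' ∈ Finset.Icc 1 t) (hℓ : ℓ ∈ Finset.Icc 1 n) :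
      RefClause Cm n r s t {⟨.R i j j', false⟩, ⟨.V i j ℓ, false⟩, ⟨.D (i-1) j' ℓ false, true⟩}
  | ltransf {i j j' ℓ ℓ' : ℕ} {b : Bool} (hi : i ∈ Finset.Icc 2 s) (hj : j ∈ Finset.Icc 1 t)
      (hj' : j' ∈ Finset.Icc 1 t) (hℓ : ℓ ∈ Finset.Icc 1 n) (hℓ' : ℓ' ∈ Finset.Icc 1 n)
      (hne : (ℓ', b) ≠ (ℓ, true)) :
      RefClause Cm n r s t
        {⟨.L i j j', false⟩, ⟨.V i j ℓ, false⟩, ⟨.D (i-1) j' ℓ' b, false⟩, ⟨.D i j ℓ' b, true⟩}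
  | rtransf {i j j' ℓ ℓ' : ℕ} {b : Bool} (hi : i ∈ Finset.Icc 2 s) (hj : j ∈ Finset.Icc 1 t)
      (hj' : j' ∈ Finset.Icc 1 t) (hℓ : ℓ ∈ Finset.Icc 1 n) (hℓ' : ℓ' ∈ Finset.Icc 1 n)
      (hne : (ℓ', b) ≠ (ℓ, false)) :
      RefClause Cm n r s t
        {⟨.R i j j', false⟩, ⟨.V i j ℓ, false⟩, ⟨.D (i-1) j' ℓ' b, false⟩, ⟨.D i j ℓ' b, true⟩}
  | empty {ℓ : ℕ} {b : Bool} (hℓ : ℓ ∈ Finset.Icc 1 n) :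
      RefClause Cm n r s t {⟨.D s t ℓ b, false⟩}
  | vdom {i j : ℕ} (hi : i ∈ Finset.Icc 2 s) (hj : j ∈ Finset.Icc 1 t) :
      RefClause Cm n r s t ((Finset.Icc 1 n).image (fun ℓ => (⟨.V i j ℓ, true⟩ : Lit RefVar)))
  | idom {j : ℕ} (hj : j ∈ Finset.Icc 1 t) :
      RefClause Cm n r s t ((Finset.Icc 1 r).image (fun m => (⟨.I j m, true⟩ : Lit RefVar)))
  | ldom {i j : ℕ} (hi : i ∈ Finset.Icc 2 s) (hj : j ∈ Finset.Icc 1 t) :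
      RefClause Cm n r s t ((Finset.Icc 1 t).image (fun j' => (⟨.L i j j', true⟩ : Lit RefVar)))
  | rdom {i j : ℕ} (hi : i ∈ Finset.Icc 2 s) (hj : j ∈ Finset.Icc 1 t) :
      RefClause Cm n r s t ((Finset.Icc 1 t).image (fun j' => (⟨.R i j j', true⟩ : Lit RefVar)))
  | vfunc {i j ℓ ℓ' : ℕ} (hi : i ∈ Finset.Icc 2 s) (hj : j ∈ Finset.Icc 1 t)
      (hℓ : ℓ ∈ Finset.Icc 1 n) (hℓ' : ℓ' ∈ Finset.Icc 1 n) (hne : ℓ ≠ ℓ') :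
      RefClause Cm n r s t {⟨.V i j ℓ, false⟩, ⟨.V i j ℓ', false⟩}
  | ifunc {j m m' : ℕ} (hj : j ∈ Finset.Icc 1 t) (hm : m ∈ Finset.Icc 1 r)
      (hm' : m' ∈ Finset.Icc 1 r) (hne : m ≠ m') :
      RefClause Cm n r s t {⟨.I j m, false⟩, ⟨.I j m', false⟩}
  | lfunc {i j j' j'' : ℕ} (hi : i ∈ Finset.Icc 2 s) (hj : j ∈ Finset.Icc 1 t)
      (hj' : j' ∈ Finset.Icc 1 t) (hj'' : j'' ∈ Finset.Icc 1 t) (hne : j' ≠ j'') :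
      RefClause Cm n r s t {⟨.L i j j', false⟩, ⟨.L i j j'', false⟩}
  | rfunc {i j j' j'' : ℕ} (hi : i ∈ Finset.Icc 2 s) (hj : j ∈ Finset.Icc 1 t)
      (hj' : j' ∈ Finset.Icc 1 t) (hj'' : j'' ∈ Finset.Icc 1 t) (hne : j' ≠ j'') :
      RefClause Cm n r s t {⟨.R i j j', false⟩, ⟨.R i j j'', false⟩}

/-- The number of home pairs mentioned in a clause in the variables of `REF^F_{s,t}`. -/
def indexWidth (E : Clause RefVar) : ℕ := (E.image (fun l => l.var.homePair)).card

/-- The variable resolved upon at level `i` in the strategy of the adversary. -/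
def levelPivot (n s i : ℕ) : ℕ := min n (s - i + 1)

/-- A description of a layered refutation: the signs of the literals of the clause at each pair,
and the second coordinates of its left and right premises. -/
structure RefState where
  sign : ℕ × ℕ → ℕ → Bool
  left : ℕ × ℕ → ℕ
  right : ℕ × ℕ → ℕ

namespace RefState

/-- The assignment described by a state, where the clause at level `i` contains the variables with
index at most `s - i`, and `ι` maps the signs of a full clause to the index of a clause it
weakens. -/
def val (n s : ℕ) (ι : (ℕ → Bool) → ℕ) (S : RefState) : RefVar → Bool
  | .D i j ℓ b => decide (ℓ ≤ s - i ∧ S.sign (i, j) ℓ = b)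
  | .L i j j' => decide (S.left (i, j) = j')
  | .R i j j' => decide (S.right (i, j) = j')
  | .V i _ ℓ => decide (ℓ = levelPivot n s i)
  | .I j m => decide (m = ι (S.sign (1, j)))

/-- At the pair `p`, the premises are in range and yield the clause at `p` by resolution on the
pivot of its level. -/
def CoherentAt (n s t : ℕ) (S : RefState) (p : ℕ × ℕ) : Prop :=
  p.1 ∈ Icc 2 s → p.2 ∈ Icc 1 t →
    (S.left p ∈ Icc 1 t ∧
      S.sign (p.1 - 1, S.left p) = Function.update (S.sign p) (levelPivot n s p.1) true) ∧
    (S.right p ∈ Icc 1 t ∧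
      S.sign (p.1 - 1, S.right p) = Function.update (S.sign p) (levelPivot n s p.1) false)

/-- Redirect the premises of `p` to `a` and `b`, and set the clauses there accordingly. -/
noncomputable def expand (n s : ℕ) (S : RefState) (p : ℕ × ℕ) (a b : ℕ) : RefState where
  sign := Function.update
    (Function.update S.sign (p.1 - 1, a) (Function.update (S.sign p) (levelPivot n s p.1) true))
    (p.1 - 1, b) (Function.update (S.sign p) (levelPivot n s p.1) false)
  left := Function.update S.left p a
  right := Function.update S.right p b

variable {n s t : ℕ} {S : RefState} {p q : ℕ × ℕ} {a b : ℕ}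

lemma expand_sign_of_ne (ha : q ≠ (p.1 - 1, a)) (hb : q ≠ (p.1 - 1, b)) :
    (S.expand n s p a b).sign q = S.sign q := by
  simp [expand, ha, hb]

lemma coherentAt_expand_self (hab : a ≠ b) (ha : a ∈ Icc 1 t) (hb : b ∈ Icc 1 t) :
    (S.expand n s p a b).CoherentAt n s t p := by
  intro hi _
  have hne (c : ℕ) : p ≠ (p.1 - 1, c) := by
    intro h
    have := congrArg Prod.fst h
    simp only [mem_Icc] at hi
    simp only at this
    omega
  have hsign := expand_sign_of_ne (n := n) (s := s) (S := S) (hne a) (hne b)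
  rw [hsign]
  simp [expand, hab, mem_Icc.mp ha, mem_Icc.mp hb]

lemma CoherentAt.expand (h : S.CoherentAt n s t q) (hqp : q ≠ p)
    (ha : q ≠ (p.1 - 1, a)) (hb : q ≠ (p.1 - 1, b))
    (hp : 2 ≤ p.1)
    (hla : q.1 = p.1 → S.left q ≠ a) (hlb : q.1 = p.1 → S.left q ≠ b)
    (hra : q.1 = p.1 → S.right q ≠ a) (hrb : q.1 = p.1 → S.right q ≠ b) :
    (S.expand n s p a b).CoherentAt n s t q := by
  intro hi hj
  have hlevel : q.1 - 1 = p.1 - 1 → q.1 = p.1 := by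
    have := (mem_Icc.mp hi).1
    omega
  have hleft : (S.expand n s p a b).left q = S.left q := by simp [RefState.expand, hqp]
  have hright : (S.expand n s p a b).right q = S.right q := by simp [RefState.expand, hqp]
  have hne {c d : ℕ} (hcd : q.1 = p.1 → c ≠ d) : (q.1 - 1, c) ≠ (p.1 - 1, d) := by
    intro h
    obtain ⟨h₁, h₂⟩ := Prod.ext_iff.mp h
    exact hcd (hlevel h₁) h₂
  rw [hleft, hright, expand_sign_of_ne ha hb, expand_sign_of_ne (hne hla) (hne hlb),
    expand_sign_of_ne (hne hra) (hne hrb)]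
  exact h hi hj

lemma val_expand_of_ne {ι : (ℕ → Bool) → ℕ} {x : RefVar} (hxp : x.homePair ≠ p)
    (ha : x.homePair ≠ (p.1 - 1, a)) (hb : x.homePair ≠ (p.1 - 1, b)) :
    (S.expand n s p a b).val n s ι x = S.val n s ι x := by
  have hsign := expand_sign_of_ne (n := n) (s := s) (S := S) ha hb
  cases x <;> simp only [RefVar.homePair] at hxp hsign <;> simp only [val, hsign] <;>
    simp [expand, hxp]

/-- A variable at the pair `p` gets a value that does not depend on the choice of the premises
of `p`, as long as these avoid one particular number. -/
lemma exists_val_expand_homePair (ι : (ℕ → Bool) → ℕ) (x : RefVar) (hx : 2 ≤ x.homePair.1) :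
    ∃ (e : ℕ) (v : Bool), ∀ a b, a ≠ e → b ≠ e →
      (S.expand n s x.homePair a b).val n s ι x = v := by
  have hne (c : ℕ) : x.homePair ≠ (x.homePair.1 - 1, c) := by
    intro h
    have := congrArg Prod.fst h
    simp only at this
    omega
  have hsign (a b : ℕ) := expand_sign_of_ne (n := n) (s := s) (S := S) (hne a) (hne b)
  cases x with
  | L i j j' =>
    refine ⟨j', false, fun a b ha _ => ?_⟩
    simp [val, expand, RefVar.homePair, ha]
  | R i j j' =>
    refine ⟨j', false, fun a b _ hb => ?_⟩
    simp [val, expand, RefVar.homePair, hb]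
  | D i j ℓ c =>
    refine ⟨0, S.val n s ι (.D i j ℓ c), fun a b _ _ => ?_⟩
    simp only [RefVar.homePair] at hsign
    simp only [val, RefVar.homePair, hsign]
  | V i j ℓ => exact ⟨0, S.val n s ι (.V i j ℓ), fun a b _ _ => rfl⟩
  | I j m =>
    refine ⟨0, S.val n s ι (.I j m), fun a b _ _ => ?_⟩
    simp only [RefVar.homePair] at hsign
    simp only [val, RefVar.homePair, hsign]

/-- A coherent state satisfies all clauses of `REF^F_{s,t}`. -/
lemma satClauseA_val {r : ℕ} {Cm : ℕ → Clause ℕ} {ι : (ℕ → Bool) → ℕ} (hn : 1 ≤ n)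
    (hs : n + 1 ≤ s)
    (hι : ∀ σ, ι σ ∈ Icc 1 r) (hιC : ∀ σ, ∀ l ∈ Cm (ι σ), σ l.var = l.pos)
    {A : Clause RefVar} (hA : RefClause Cm n r s t A)
    (hS : ∀ l ∈ A, S.CoherentAt n s t l.var.homePair) :
    SatClauseA (S.val n s ι) A := by
  by_contra hsat
  have hfalse : ∀ l ∈ A, S.val n s ι l.var ≠ l.pos := fun l hl h => hsat ⟨l, hl, h⟩
  clear hsat
  cases hA with
  | @ax j m ℓ b hj hm hℓ hmem =>
    simp only [mem_insert, mem_singleton, forall_eq_or_imp, forall_eq, val] at hfalse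
    obtain ⟨h₁, h₂⟩ := hfalse
    simp only [mem_Icc] at hℓ
    have hm' : m = ι (S.sign (1, j)) := by simpa using h₁
    subst hm'
    have := hιC _ _ hmem
    simp only at this
    apply h₂
    simp only [this, and_true, decide_eq_true_eq]
    omega
  | nontaut hi hj hℓ =>
    simp only [mem_insert, mem_singleton, forall_eq_or_imp, forall_eq, val] at hfalse
    grind
  | @lcut i j j' ℓ hi hj hj' hℓ =>
    have hco := (hS ⟨.L i j j', false⟩ (by simp) hi hj).1.2
    simp only [RefVar.homePair] at hco
    simp only [mem_insert, mem_singleton, forall_eq_or_imp, forall_eq, val] at hfalse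
    obtain ⟨h₁, h₂, h₃⟩ := hfalse
    have h₁ : S.left (i, j) = j' := by simpa using h₁
    have h₂ : ℓ = levelPivot n s i := by simpa using h₂
    subst h₁ h₂
    simp only [mem_Icc] at hi
    apply h₃
    simp only [hco, Function.update_self, and_true, decide_eq_true_eq]
    unfold levelPivot
    omega
  | @rcut i j j' ℓ hi hj hj' hℓ =>
    have hco := (hS ⟨.R i j j', false⟩ (by simp) hi hj).2.2
    simp only [RefVar.homePair] at hco
    simp only [mem_insert, mem_singleton, forall_eq_or_imp, forall_eq, val] at hfalse
    obtain ⟨h₁, h₂, h₃⟩ := hfalse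
    have h₁ : S.right (i, j) = j' := by simpa using h₁
    have h₂ : ℓ = levelPivot n s i := by simpa using h₂
    subst h₁ h₂
    simp only [mem_Icc] at hi
    apply h₃
    simp only [hco, Function.update_self, and_true, decide_eq_true_eq]
    unfold levelPivot
    omega
  | @ltransf i j j' ℓ ℓ' b hi hj hj' hℓ hℓ' hne =>
    have hco := (hS ⟨.L i j j', false⟩ (by simp) hi hj).1.2
    simp only [RefVar.homePair] at hco
    simp only [mem_insert, mem_singleton, forall_eq_or_imp, forall_eq, val] at hfalse
    obtain ⟨h₁, h₂, h₃, h₄⟩ := hfalse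
    have h₁ : S.left (i, j) = j' := by simpa using h₁
    have h₂ : ℓ = levelPivot n s i := by simpa using h₂
    subst h₁ h₂
    have h₃ : ℓ' ≤ s - (i - 1) ∧ S.sign (i - 1, S.left (i, j)) ℓ' = b := by simpa using h₃
    rw [hco] at h₃
    have hℓne : ℓ' ≠ levelPivot n s i := by
      rintro rfl
      simp_all
    rw [Function.update_of_ne hℓne] at h₃
    apply h₄
    simp only [h₃.2, and_true, decide_eq_true_eq]
    simp only [mem_Icc] at hi hℓ'
    unfold levelPivot at hℓne
    omega
  | @rtransf i j j' ℓ ℓ' b hi hj hj' hℓ hℓ' hne =>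
    have hco := (hS ⟨.R i j j', false⟩ (by simp) hi hj).2.2
    simp only [RefVar.homePair] at hco
    simp only [mem_insert, mem_singleton, forall_eq_or_imp, forall_eq, val] at hfalse
    obtain ⟨h₁, h₂, h₃, h₄⟩ := hfalse
    have h₁ : S.right (i, j) = j' := by simpa using h₁
    have h₂ : ℓ = levelPivot n s i := by simpa using h₂
    subst h₁ h₂
    have h₃ : ℓ' ≤ s - (i - 1) ∧ S.sign (i - 1, S.right (i, j)) ℓ' = b := by simpa using h₃
    rw [hco] at h₃
    have hℓne : ℓ' ≠ levelPivot n s i := by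
      rintro rfl
      simp_all
    rw [Function.update_of_ne hℓne] at h₃
    apply h₄
    simp only [h₃.2, and_true, decide_eq_true_eq]
    simp only [mem_Icc] at hi hℓ'
    unfold levelPivot at hℓne
    omega
  | @empty ℓ b hℓ =>
    simp only [mem_Icc] at hℓ
    simp only [mem_singleton, forall_eq, val] at hfalse
    simp at hfalse
    omega
  | @vdom i j hi hj =>
    refine hfalse ⟨.V i j (levelPivot n s i), true⟩ (mem_image_of_mem _ ?_) (by simp [val])
    simp only [mem_Icc, levelPivot]
    omega
  | @idom j hj =>
    exact hfalse ⟨.I j (ι (S.sign (1, j))), true⟩ (mem_image_of_mem _ (hι _)) (by simp [val])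
  | @ldom i j hi hj =>
    have hco := hS ⟨.L i j 1, true⟩ (mem_image_of_mem _ (by simp only [mem_Icc] at hj ⊢; omega))
      hi hj
    exact hfalse ⟨.L i j (S.left (i, j)), true⟩ (mem_image_of_mem _ hco.1.1) (by simp [val])
  | @rdom i j hi hj =>
    have hco := hS ⟨.R i j 1, true⟩ (mem_image_of_mem _ (by simp only [mem_Icc] at hj ⊢; omega))
      hi hj
    exact hfalse ⟨.R i j (S.right (i, j)), true⟩ (mem_image_of_mem _ hco.2.1) (by simp [val])
  | vfunc hi hj hℓ hℓ' hne =>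
    simp only [mem_insert, mem_singleton, forall_eq_or_imp, forall_eq, val] at hfalse
    grind
  | ifunc hj hm hm' hne =>
    simp only [mem_insert, mem_singleton, forall_eq_or_imp, forall_eq, val] at hfalse
    grind
  | lfunc hi hj hj' hj'' hne =>
    simp only [mem_insert, mem_singleton, forall_eq_or_imp, forall_eq, val] at hfalse
    grind
  | rfunc hi hj hj' hj'' hne =>
    simp only [mem_insert, mem_singleton, forall_eq_or_imp, forall_eq, val] at hfalse
    grind

/-- The state falsifies the clause and is coherent at all pairs mentioned in it. -/
def Refutes (n s t : ℕ) (ι : (ℕ → Bool) → ℕ) (S : RefState) (E : Clause RefVar) : Prop :=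
  ∀ l ∈ E, S.val n s ι l.var = !l.pos ∧ S.CoherentAt n s t l.var.homePair

/-- If at most `w` pairs are in use, including `p`, then two unused numbers in `[t]` are available
as premises of `p`. -/
lemma exists_fresh_premises {w : ℕ} (hwt : 2 * w < t) (S : RefState) (hp : 2 ≤ p.1) (e : ℕ)
    {M : Finset (ℕ × ℕ)} (hM : M.card + 1 ≤ w) :
    ∃ a ∈ Icc 1 t, ∃ b ∈ Icc 1 t, a ≠ b ∧ a ≠ e ∧ b ≠ e ∧ ∀ c, c = a ∨ c = b →
      ∀ q ∈ M, q ≠ (p.1 - 1, c) ∧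
        (q.1 = p.1 → S.left q ≠ c ∧ S.right q ≠ c) := by
  let U : Finset ℕ := insert e (M.biUnion fun q =>
    if q.1 = p.1 then {S.left q, S.right q} else {q.2})
  have hU : U.card ≤ M.card * 2 + 1 := by
    refine (card_insert_le _ _).trans (Nat.succ_le_succ (card_biUnion_le_card_mul _ _ _ ?_))
    intro q _
    split_ifs
    · exact card_le_two
    · simp
  have hcard : 1 < (Icc 1 t \ U).card := by
    have := le_card_sdiff U (Icc 1 t)
    simp only [Nat.card_Icc] at this
    omega
  obtain ⟨a, ha, b, hb, hab⟩ := one_lt_card.mp hcard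
  have key : ∀ c, c ∈ Icc 1 t \ U → c ∈ Icc 1 t ∧ c ≠ e ∧ ∀ q ∈ M, q ≠ (p.1 - 1, c) ∧
      (q.1 = p.1 → S.left q ≠ c ∧ S.right q ≠ c) := by
    intro c hc
    simp only [U, mem_sdiff, mem_insert, mem_biUnion, not_or, not_exists, not_and] at hc
    refine ⟨hc.1, hc.2.1, fun q hq => ⟨?_, fun h => ?_⟩⟩
    · rintro rfl
      have := hc.2.2 _ hq
      rw [if_neg (by simp only; omega)] at this
      simp at this
    · have := hc.2.2 _ hq
      rw [if_pos h] at this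
      simp only [mem_insert, mem_singleton, not_or] at this
      exact ⟨Ne.symm this.1, Ne.symm this.2⟩
  refine ⟨a, (key a ha).1, b, (key b hb).1, hab, (key a ha).2.1, (key b hb).2.1, ?_⟩
  rintro c (rfl | rfl)
  · exact (key _ ha).2.2
  · exact (key _ hb).2.2

/-- If the conclusion of a resolution step is refuted by a state, then so is one of its premises,
provided the premises have index-width at most `w`. -/
lemma Refutes.exists_premise {w : ℕ} (hwt : 2 * w < t) {ι : (ℕ → Bool) → ℕ}
    {E : Clause RefVar} (hS : S.Refutes n s t ι E) (x : RefVar) (C : Bool → Clause RefVar)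
    (hx : ∀ v, ⟨x, v⟩ ∈ C v) (hE : ∀ v, (C v).erase ⟨x, v⟩ ⊆ E)
    (hw : ∀ v, indexWidth (C v) ≤ w) :
    ∃ (S' : RefState) (v : Bool), S'.Refutes n s t ι (C v) := by
  have hC (v : Bool) (l : Lit RefVar) (hl : l ∈ C v) : l = ⟨x, v⟩ ∨ l ∈ E :=
    or_iff_not_imp_left.mpr fun h => hE v (mem_erase.mpr ⟨h, hl⟩)
  by_cases hco : S.CoherentAt n s t x.homePair
  · refine ⟨S, !S.val n s ι x, fun l hl => ?_⟩
    rcases hC _ l hl with rfl | hl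
    · exact ⟨by simp, hco⟩
    · exact hS l hl
  have hrange : x.homePair.1 ∈ Icc 2 s ∧ x.homePair.2 ∈ Icc 1 t := by
    by_contra h
    exact hco fun h₁ h₂ => absurd ⟨h₁, h₂⟩ h
  have hlevel : 2 ≤ x.homePair.1 := (mem_Icc.mp hrange.1).1
  have hmention (l : Lit RefVar) (hl : l ∈ E) : l.var.homePair ≠ x.homePair :=
    fun h => hco (h ▸ (hS l hl).2)
  obtain ⟨e, v, hv⟩ := exists_val_expand_homePair (n := n) (s := s) (S := S) ι x hlevel
  let M := ((C !v).image fun l => l.var.homePair).erase x.homePair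
  have hM : M.card + 1 ≤ w :=
    (card_erase_add_one (mem_image_of_mem (fun l : Lit RefVar => l.var.homePair) (hx _))).trans_le
      (hw _)
  obtain ⟨a, ha, b, hb, hab, hae, hbe, hfresh⟩ := exists_fresh_premises hwt S hlevel e hM
  refine ⟨S.expand n s x.homePair a b, !v, fun l hl => ?_⟩
  rcases hC _ l hl with rfl | hlE
  · exact ⟨by simp [hv a b hae hbe], coherentAt_expand_self hab ha hb⟩
  · have hne := hmention l hlE
    have hlM : l.var.homePair ∈ M := mem_erase.mpr ⟨hne, mem_image_of_mem _ hl⟩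
    obtain ⟨ha₁, ha₂⟩ := hfresh a (.inl rfl) _ hlM
    obtain ⟨hb₁, hb₂⟩ := hfresh b (.inr rfl) _ hlM
    refine ⟨(val_expand_of_ne hne ha₁ hb₁).trans (hS l hlE).1, ?_⟩
    exact (hS l hlE).2.expand hne ha₁ hb₁ hlevel (fun h => (ha₂ h).1)
      (fun h => (hb₂ h).1) (fun h => (ha₂ h).2) (fun h => (hb₂ h).2)

end RefState

/-- Every full clause over an unsatisfiable CNF is a weakening of one of the clauses. -/
lemma Unsat.exists_falsified {r : ℕ} {Cm : ℕ → Clause ℕ}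
    (hunsat : Unsat {E : Clause ℕ | ∃ m ∈ Finset.Icc 1 r, E = Cm m}) (σ : ℕ → Bool) :
    ∃ m ∈ Icc 1 r, ∀ l ∈ Cm m, σ l.var = l.pos := by
  by_contra! h
  refine hunsat ⟨fun ℓ => !σ ℓ, ?_⟩
  rintro _ ⟨m, hm, rfl⟩
  obtain ⟨l, hl, hne⟩ := h m hm
  exact ⟨l, hl, by cases h : σ l.var <;> simp_all⟩

/-- For `w > 0`, `2 ≤ n+1 ≤ s`, `2w < t` and `F` an unsatisfiable CNF of
`r` clauses in `n` variables, every resolution refutation of `REF^F_{s,t}` has index-width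
greater than `w`. -/
theorem refF_index_width_lower_bound
    (w n r s t : ℕ) (hw : 0 < w) (hn : 2 ≤ n + 1) (hs : n + 1 ≤ s) (hwt : 2 * w < t)
    (Cm : ℕ → Clause ℕ)
    (hvars : ∀ m ∈ Finset.Icc 1 r, ∀ l ∈ Cm m, l.var ∈ Finset.Icc 1 n)
    (hunsat : Unsat {E : Clause ℕ | ∃ m ∈ Finset.Icc 1 r, E = Cm m}) :
    ∀ P : List (Clause RefVar),
      IsResRefutation {E | RefClause Cm n r s t E} P →
      ∃ E ∈ P, w < indexWidth E := by
  intro P hP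
  by_contra! hwidth
  obtain ⟨hne, hlast, hstep⟩ := hP
  choose ι hι hιC using hunsat.exists_falsified
  have main : ∀ (k : ℕ) (hk : k < P.length) (S : RefState),
      ¬ S.Refutes n s t ι (P.get ⟨k, hk⟩) := by
    intro k
    induction k using Nat.strong_induction_on with
    | _ k ih =>
      intro hk S hS
      rcases hstep ⟨k, hk⟩ with ⟨A, hA, hsub⟩ | ⟨jv, jw, hjv, hjw, x, hxv, hxw, hsub⟩
      · obtain ⟨l, hl, hsat⟩ := RefState.satClauseA_val (by omega) hs hι hιC hA
          fun l hl => (hS l (hsub hl)).2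
        have := (hS l (hsub hl)).1
        simp_all
      · obtain ⟨S', v, hS'⟩ := hS.exists_premise hwt x
          (fun v => if v then P.get jv else P.get jw)
          (by simp only [Bool.forall_bool]; exact ⟨hxw, hxv⟩)
          (by
            simp only [Bool.forall_bool]
            exact ⟨subset_union_right.trans hsub, subset_union_left.trans hsub⟩)
          (by
            simp only [Bool.forall_bool]
            exact ⟨hwidth _ (P.get_mem _), hwidth _ (P.get_mem _)⟩)
        cases v
        · exact ih jw hjw jw.2 S' hS'
        · exact ih jv hjv jv.2 S' hS'
  obtain ⟨k, hk, hget⟩ := List.getElem_of_mem (List.mem_of_getLast? hlast)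
  refine main k hk ⟨fun _ _ => true, fun _ => 0, fun _ => 0⟩ ?_
  intro l hl
  rw [List.get_eq_getElem, hget] at hl
  simp at hl
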